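/- Let F ∈ ℝ[x₁, …, x_N], let d₁ := deg_{x₁} F, and write F = S·x₁^{d₁} + (terms of lower degree in x₁) with S ∈ ℝ[x₂, …, x_N]. Set T_{lm} := F·F_{lm} − F_l·F_m and A_{lm} := S·S_{lm} − S_l·S_m, where subscripts denote partial derivatives. Then for every subset J ⊆ {1, …, N} with 1 ∈ J and |J| = d, the coefficient of x₁^{2(N−d)·d₁} in det((T_{lm})_{l,m ∉ J}) equals det((A_{lm})_{l,m ∉ J}). -/

import Mathlib

open MvPolynomial

namespace MvPolynomial

variable {σ R : Type*} [CommRing R]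

/-- `p = a * X k ^ n + (terms of degree less than n in X k)`, where `a` does not involve `X k`. -/
def HasLeadingTerm (k : σ) (n : ℕ) (p a : MvPolynomial σ R) : Prop :=
  degreeOf k a = 0 ∧ ∃ r, p = a * X k ^ n + r ∧ (r = 0 ∨ degreeOf k r < n)

theorem degreeOf_pderiv_le {k l : σ} (h : l ≠ k) (p : MvPolynomial σ R) :
    degreeOf k (pderiv l p) ≤ degreeOf k p := by
  classical
  refine degreeOf_le_iff.2 fun m hm => ?_
  have hm' : m + Finsupp.single l 1 ∈ p.support := by
    rw [mem_support_iff, coeff_pderiv] at hm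
    exact mem_support_iff.2 (left_ne_zero_of_mul hm)
  simpa [h] using monomial_le_degreeOf k hm'

theorem degreeOf_X_pow_le (k : σ) (n : ℕ) : degreeOf k (X k ^ n : MvPolynomial σ R) ≤ n := by
  cases subsingleton_or_nontrivial R
  · simp [Subsingleton.elim (X k ^ n : MvPolynomial σ R) 0]
  · simp

namespace HasLeadingTerm

variable {k : σ} {n m : ℕ} {p q a b : MvPolynomial σ R}

theorem zero (k : σ) (n : ℕ) : HasLeadingTerm k n (0 : MvPolynomial σ R) 0 :=
  ⟨degreeOf_zero k, 0, by simp, Or.inl rfl⟩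

theorem one (k : σ) : HasLeadingTerm k 0 (1 : MvPolynomial σ R) 1 :=
  ⟨degreeOf_one k, 0, by simp, Or.inl rfl⟩

theorem neg (hp : HasLeadingTerm k n p a) : HasLeadingTerm k n (-p) (-a) := by
  obtain ⟨ha, r, rfl, hr⟩ := hp
  exact ⟨by rwa [degreeOf_neg], -r, by ring, by rwa [neg_eq_zero, degreeOf_neg]⟩

theorem add (hp : HasLeadingTerm k n p a) (hq : HasLeadingTerm k n q b) :
    HasLeadingTerm k n (p + q) (a + b) := by
  obtain ⟨ha, r, rfl, hr⟩ := hp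
  obtain ⟨hb, s, rfl, hs⟩ := hq
  refine ⟨by have := degreeOf_add_le k a b; simp_all, r + s, by ring, ?_⟩
  rcases hr with rfl | hr
  · simpa using hs
  rcases hs with rfl | hs
  · simpa using Or.inr hr
  exact Or.inr ((degreeOf_add_le k r s).trans_lt (max_lt hr hs))

theorem sub (hp : HasLeadingTerm k n p a) (hq : HasLeadingTerm k n q b) :
    HasLeadingTerm k n (p - q) (a - b) := by
  simpa only [sub_eq_add_neg] using hp.add hq.neg

theorem degreeOf_le (hp : HasLeadingTerm k n p a) : degreeOf k p ≤ n := by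
  obtain ⟨ha, r, rfl, hr⟩ := hp
  have hX := degreeOf_X_pow_le (R := R) k n
  have hmul := degreeOf_mul_le k a (X k ^ n)
  refine (degreeOf_add_le k _ _).trans (max_le (by lia) ?_)
  rcases hr with rfl | hr
  · simp
  · exact hr.le

theorem mul (hp : HasLeadingTerm k n p a) (hq : HasLeadingTerm k m q b) :
    HasLeadingTerm k (n + m) (p * q) (a * b) := by
  have hpn := hp.degreeOf_le
  obtain ⟨ha, r, rfl, hr⟩ := hp
  obtain ⟨hb, s, rfl, hs⟩ := hq
  refine ⟨by have := degreeOf_mul_le k a b; lia,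
    (a * X k ^ n + r) * s + r * (b * X k ^ m), by ring, ?_⟩
  have hX := degreeOf_X_pow_le (R := R) k m
  have h₁ := degreeOf_mul_le k (a * X k ^ n + r) s
  have h₂ := degreeOf_mul_le k r (b * X k ^ m)
  have h₃ := degreeOf_mul_le k b (X k ^ m)
  rcases hr with rfl | hr
  · rcases hs with rfl | hs
    · simp
    · right
      rw [zero_mul, add_zero]
      lia
  · right
    rcases hs with rfl | hs
    · rw [mul_zero, zero_add]
      lia
    · exact (degreeOf_add_le k _ _).trans_lt (max_lt (by lia) (by lia))

theorem pderiv {l : σ} (hl : l ≠ k) (hp : HasLeadingTerm k n p a) :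
    HasLeadingTerm k n (pderiv l p) (pderiv l a) := by
  obtain ⟨ha, r, rfl, hr⟩ := hp
  refine ⟨Nat.le_zero.1 (ha ▸ degreeOf_pderiv_le hl a), MvPolynomial.pderiv l r, ?_, ?_⟩
  · rw [map_add, pderiv_mul, pderiv_pow, pderiv_X_of_ne hl.symm]
    ring
  · rcases hr with rfl | hr
    · simp
    · exact Or.inr ((degreeOf_pderiv_le hl r).trans_lt hr)

theorem sum {ι : Type*} (s : Finset ι) {f g : ι → MvPolynomial σ R}
    (h : ∀ i ∈ s, HasLeadingTerm k n (f i) (g i)) :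
    HasLeadingTerm k n (∑ i ∈ s, f i) (∑ i ∈ s, g i) := by
  induction s using Finset.cons_induction with
  | empty => exact zero k n
  | cons i s hi ih =>
    rw [Finset.sum_cons, Finset.sum_cons]
    exact (h i (Finset.mem_cons_self i s)).add
      (ih fun j hj => h j (Finset.mem_cons_of_mem hj))

theorem prod {ι : Type*} (s : Finset ι) {f g : ι → MvPolynomial σ R}
    (h : ∀ i ∈ s, HasLeadingTerm k n (f i) (g i)) :
    HasLeadingTerm k (s.card * n) (∏ i ∈ s, f i) (∏ i ∈ s, g i) := by
  induction s using Finset.cons_induction with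
  | empty => simpa using one k
  | cons i s hi ih =>
    rw [Finset.prod_cons, Finset.prod_cons, Finset.card_cons, Nat.succ_mul, Nat.add_comm]
    exact (h i (Finset.mem_cons_self i s)).mul
      (ih fun j hj => h j (Finset.mem_cons_of_mem hj))

theorem det {ι : Type*} [Fintype ι] [DecidableEq ι] {A B : Matrix ι ι (MvPolynomial σ R)}
    (h : ∀ i j, HasLeadingTerm k n (A i j) (B i j)) :
    HasLeadingTerm k (Fintype.card ι * n) A.det B.det := by
  rw [Matrix.det_apply, Matrix.det_apply]
  refine sum _ fun τ _ => ?_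
  have hprod := prod Finset.univ fun i _ => h (τ i) i
  rcases Int.units_eq_one_or (Equiv.Perm.sign τ) with hτ | hτ
  · simpa [hτ] using hprod
  · simpa [hτ] using hprod.neg

end HasLeadingTerm

end MvPolynomial

/-- The distinguished variable `x₁` is denoted `k`; the hypotheses
`hdecomp`, `hS`, `hR₀` express that `S` is the leading coefficient of `F` in `x₁`,
i.e. `F = S·x₁^{d₁} + (terms of lower degree in x₁)` with `S ∈ ℝ[x₂,…,x_N]`.
The conclusion expresses that the coefficient of `x₁^{2(N−d)d₁}` in the minor
`det((T_{lm})_{l,m∉J})` equals `det((A_{lm})_{l,m∉J})`, where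
`T_{lm} = F·F_{lm} − F_l·F_m` and `A_{lm} = S·S_{lm} − S_l·S_m`. -/
theorem statement17 (N : ℕ) (F S R₀ : MvPolynomial (Fin N) ℝ) (k : Fin N)
    (hdecomp : F = S * X k ^ F.degreeOf k + R₀)
    (hS : degreeOf k S = 0)
    (hR₀ : R₀ = 0 ∨ degreeOf k R₀ < F.degreeOf k)
    (J : Finset (Fin N)) (hkJ : k ∈ J) :
    ∃ R' : MvPolynomial (Fin N) ℝ,
      Matrix.det (Matrix.of fun l m : {x : Fin N // x ∉ J} =>
          F * pderiv l.val (pderiv m.val F) - pderiv l.val F * pderiv m.val F)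
        = Matrix.det (Matrix.of fun l m : {x : Fin N // x ∉ J} =>
            S * pderiv l.val (pderiv m.val S) - pderiv l.val S * pderiv m.val S)
          * X k ^ (2 * (N - J.card) * F.degreeOf k) + R' ∧
      (R' = 0 ∨ degreeOf k R' < 2 * (N - J.card) * F.degreeOf k) := by
  have hF : HasLeadingTerm k (F.degreeOf k) F S := ⟨hS, R₀, hdecomp, hR₀⟩
  have hne (l : {x : Fin N // x ∉ J}) : l.val ≠ k := fun h => l.property (h ▸ hkJ)
  have hcard : Fintype.card {x : Fin N // x ∉ J} * (F.degreeOf k + F.degreeOf k)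
      = 2 * (N - J.card) * F.degreeOf k := by
    rw [Fintype.card_subtype_compl, Fintype.card_fin, Fintype.card_coe]
    ring
  rw [← hcard]
  exact (HasLeadingTerm.det fun l m =>
    (hF.mul ((hF.pderiv (hne m)).pderiv (hne l))).sub
      ((hF.pderiv (hne l)).mul (hF.pderiv (hne m)))).2
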